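/- There is a constant C (independent of the formula) such that for every PML formula φ of modal depth at most 1 (φ ∈ PML₁, with arbitrary modalities id, E_in, E_out, ⊤), there exist an MPNN M_φ ∈ M_mean with at most C·(deg(φ)+1) layers and a natural number e ≤ C·(deg(φ)+1) such that M_φ recognises φ over the class of all regular pointed graphs (G,v) whose focus v is strongly marked by colour p, with certainty c(|V|) = 1/|V|^e. -/

import Mathlib

namespace PMLMPNN

/-- Modalities of Peano modal logic. -/
inductive Modality where
  | id | ein | eout | top
deriving DecidableEq

/-- A normalised integer inequality `∑ i, a i * ∏ (mon i) ≤ b`. -/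
structure PeanoIneq (m : ℕ) where
  K : ℕ
  a : Fin K → ℤ
  mon : Fin K → List (Fin m)
  b : ℤ

/-- Value of a monomial (a list of variables) under an assignment. -/
def monValZ {m : ℕ} (c : Fin m → ℕ) (l : List (Fin m)) : ℤ :=
  (l.map (fun j => (c j : ℤ))).prod

def PeanoIneq.sat {m : ℕ} (t : PeanoIneq m) (c : Fin m → ℕ) : Bool :=
  decide ((∑ i, t.a i * monValZ c (t.mon i)) ≤ t.b)

def PeanoIneq.deg {m : ℕ} (t : PeanoIneq m) : ℕ :=
  Finset.univ.sup (fun i => (t.mon i).length)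

/-- Peano formulas: Boolean combinations of normalised inequalities. -/
inductive PeanoFormula (m : ℕ) where
  | ineq : PeanoIneq m → PeanoFormula m
  | not : PeanoFormula m → PeanoFormula m
  | and : PeanoFormula m → PeanoFormula m → PeanoFormula m

def PeanoFormula.sat {m : ℕ} (c : Fin m → ℕ) : PeanoFormula m → Bool
  | .ineq t => t.sat c
  | .not ψ => ! ψ.sat c
  | .and ψ₁ ψ₂ => ψ₁.sat c && ψ₂.sat c

def PeanoFormula.deg {m : ℕ} : PeanoFormula m → ℕ
  | .ineq t => t.deg
  | .not ψ => ψ.deg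
  | .and ψ₁ ψ₂ => max ψ₁.deg ψ₂.deg

/-- A term is homogeneous if it has no constant part and all its monomials
have the same degree. -/
def PeanoIneq.Homog {m : ℕ} (t : PeanoIneq m) : Prop :=
  t.b = 0 ∧ ∀ i, (t.mon i).length = t.deg

def PeanoFormula.Homog {m : ℕ} : PeanoFormula m → Prop
  | .ineq t => t.Homog
  | .not ψ => ψ.Homog
  | .and ψ₁ ψ₂ => ψ₁.Homog ∧ ψ₂.Homog

/-- The set of monomials occurring in a Peano formula. -/
def PeanoFormula.mons {m : ℕ} : PeanoFormula m → Finset (List (Fin m))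
  | .ineq t => Finset.univ.image t.mon
  | .not ψ => ψ.mons
  | .and ψ₁ ψ₂ => ψ₁.mons ∪ ψ₂.mons

/-- The set of constants occurring in a Peano formula. -/
def PeanoFormula.consts {m : ℕ} : PeanoFormula m → Finset ℤ
  | .ineq t => {t.b}
  | .not ψ => ψ.consts
  | .and ψ₁ ψ₂ => ψ₁.consts ∪ ψ₂.consts

/-- PML formulas over `k` colours (propositions). -/
inductive PML (k : ℕ) where
  | prop : Fin k → PML k
  | not : PML k → PML k
  | and : PML k → PML k → PML k
  | modal : (m : ℕ) → (Fin m → Modality) → PeanoFormula m → (Fin m → PML k) → PML k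

def PML.md {k : ℕ} : PML k → ℕ
  | .prop _ => 0
  | .not φ => φ.md
  | .and φ₁ φ₂ => max φ₁.md φ₂.md
  | .modal _ _ _ φs => 1 + Finset.univ.sup (fun i => (φs i).md)

def PML.deg {k : ℕ} : PML k → ℕ
  | .prop _ => 0
  | .not φ => φ.deg
  | .and φ₁ φ₂ => max φ₁.deg φ₂.deg
  | .modal _ _ ψ φs => max ψ.deg (Finset.univ.sup (fun i => (φs i).deg))

def PML.onlyTop {k : ℕ} : PML k → Prop
  | .prop _ => True
  | .not φ => φ.onlyTop
  | .and φ₁ φ₂ => φ₁.onlyTop ∧ φ₂.onlyTop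
  | .modal _ π _ φs => (∀ i, π i = Modality.top) ∧ (∀ i, (φs i).onlyTop)

def PML.onlyE {k : ℕ} : PML k → Prop
  | .prop _ => True
  | .not φ => φ.onlyE
  | .and φ₁ φ₂ => φ₁.onlyE ∧ φ₂.onlyE
  | .modal _ π _ φs => (∀ i, π i = Modality.ein ∨ π i = Modality.eout) ∧ (∀ i, (φs i).onlyE)

/-- Propositional formulas: no modal subformula at all. -/
def PML.NoModal {k : ℕ} : PML k → Prop
  | .prop _ => True
  | .not φ => φ.NoModal
  | .and φ₁ φ₂ => φ₁.NoModal ∧ φ₂.NoModal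
  | .modal _ _ _ _ => False

/-- Subformula relation. -/
inductive PML.Sub {k : ℕ} : PML k → PML k → Prop where
  | refl (φ : PML k) : PML.Sub φ φ
  | not {χ φ : PML k} : PML.Sub χ φ → PML.Sub χ (.not φ)
  | and_left {χ φ₁ φ₂ : PML k} : PML.Sub χ φ₁ → PML.Sub χ (.and φ₁ φ₂)
  | and_right {χ φ₁ φ₂ : PML k} : PML.Sub χ φ₂ → PML.Sub χ (.and φ₁ φ₂)
  | modal {χ : PML k} {m : ℕ} {π : Fin m → Modality} {ψ : PeanoFormula m}
      {φs : Fin m → PML k} (i : Fin m) :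
      PML.Sub χ (φs i) → PML.Sub χ (.modal m π ψ φs)

/-- Finite directed node-labelled graphs with `k` colours; labels in `{0,1}^k`
are represented by Boolean vectors. -/
structure Graph (k : ℕ) where
  n : ℕ
  E : Finset (Fin n × Fin n)
  L : Fin n → Fin k → Bool

def Graph.neighIn {k : ℕ} (G : Graph k) (v : Fin G.n) : Finset (Fin G.n) :=
  Finset.univ.filter (fun u => (u, v) ∈ G.E)

def Graph.neighOut {k : ℕ} (G : Graph k) (v : Fin G.n) : Finset (Fin G.n) :=
  Finset.univ.filter (fun u => (v, u) ∈ G.E)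

def Graph.Regular {k : ℕ} (G : Graph k) : Prop :=
  ∀ u v : Fin G.n,
    (G.neighIn u).card = (G.neighIn v).card ∧ (G.neighOut u).card = (G.neighOut v).card

/-- `v` is marked by colour `p`. -/
def Graph.MarkedBy {k : ℕ} (G : Graph k) (v : Fin G.n) (p : Fin k) : Prop :=
  ∀ u : Fin G.n, G.L u p = true ↔ u = v

/-- `v` is strongly marked by colour `p`: marked and `v ∈ neigh(v)`. -/
def Graph.StronglyMarkedBy {k : ℕ} (G : Graph k) (v : Fin G.n) (p : Fin k) : Prop :=
  G.MarkedBy v p ∧ (v, v) ∈ G.E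

def Graph.modSem {k : ℕ} (G : Graph k) (v : Fin G.n) : Modality → Finset (Fin G.n)
  | .id => {v}
  | .ein => G.neighIn v
  | .eout => G.neighOut v
  | .top => Finset.univ

/-- Satisfaction of PML formulas on pointed graphs. -/
def PML.sat {k : ℕ} (G : Graph k) : PML k → Fin G.n → Bool
  | .prop i, v => G.L v i
  | .not φ, v => ! PML.sat G φ v
  | .and φ₁ φ₂, v => PML.sat G φ₁ v && PML.sat G φ₂ v
  | .modal _ π ψ φs, v =>
      ψ.sat (fun i => ((G.modSem v (π i)).filter (fun u => PML.sat G (φs i) u = true)).card)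

/-- Feedforward neural networks with ReLU activations and rational weights. -/
inductive FNN : ℕ → ℕ → Type where
  | layer {din dout : ℕ} (w : Fin dout → Fin din → ℚ) (b : Fin dout → ℚ) : FNN din dout
  | comp {d₁ d₂ d₃ : ℕ} : FNN d₁ d₂ → FNN d₂ d₃ → FNN d₁ d₃

def FNN.eval : {din dout : ℕ} → FNN din dout → (Fin din → ℚ) → Fin dout → ℚ
  | _, _, .layer w b, x => fun j => max 0 (b j + ∑ i, w j i * x i)
  | _, _, .comp f g, x => g.eval (f.eval x)

/-- Aggregation functions on finite multisets of vectors. -/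
inductive Agg where
  | mean | sum | max
deriving DecidableEq

noncomputable def Agg.eval {d : ℕ} : Agg → Multiset (Fin d → ℚ) → Fin d → ℚ
  | .mean, s => fun i => (s.map (fun f => f i)).sum / (Multiset.card s : ℚ)
  | .sum, s => fun i => (s.map (fun f => f i)).sum
  | .max, s => fun i => ((s.map (fun f => f i)).toList).foldr Max.max 0

/-- One MPNN layer: a combination function (an FNN applied to the previous
state and the three aggregated messages) together with the choice of the two
local and the global aggregation functions. -/
structure MPNNLayer (din dout : ℕ) where
  comb : FNN (din + din + din + din) dout
  locIn : Agg
  locOut : Agg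
  glob : Agg

noncomputable def MPNNLayer.step {k din dout : ℕ} (l : MPNNLayer din dout) (G : Graph k)
    (x : Fin G.n → Fin din → ℚ) : Fin G.n → Fin dout → ℚ :=
  fun v => l.comb.eval
    (Fin.append (Fin.append (Fin.append (x v)
      (l.locIn.eval ((G.neighIn v).val.map x)))
      (l.locOut.eval ((G.neighOut v).val.map x)))
      (l.glob.eval ((Finset.univ : Finset (Fin G.n)).val.map x)))

/-- A message passing neural network: `L` layers with state dimensions
`dims 0, dims 1, …, dims L`. -/
structure MPNN where
  L : ℕ
  dims : ℕ → ℕ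
  layers : (i : ℕ) → MPNNLayer (dims i) (dims (i + 1))

/-- Initial state: the label of the node (padded with zeros if needed). -/
def Graph.init {k : ℕ} (G : Graph k) (d : ℕ) (v : Fin G.n) : Fin d → ℚ :=
  fun j => if h : (j : ℕ) < k then (if G.L v ⟨j, h⟩ then 1 else 0) else 0

/-- The state `x_v^{(i)}` computed by `M` on `G`. -/
noncomputable def MPNN.state {k : ℕ} (M : MPNN) (G : Graph k) : (i : ℕ) → Fin G.n → Fin (M.dims i) → ℚ
  | 0 => fun v => G.init (M.dims 0) v
  | i + 1 => (M.layers i).step G (M.state G i)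

/-- Last coordinate of a vector. -/
def lastVal {d : ℕ} (x : Fin d → ℚ) : ℚ :=
  if h : 0 < d then x ⟨d - 1, Nat.sub_lt h Nat.one_pos⟩ else 0

/-- The output `M(G,v)_⊥`: the last coordinate of the final state. -/
noncomputable def MPNN.out {k : ℕ} (M : MPNN) (G : Graph k) (v : Fin G.n) : ℚ :=
  lastVal (M.state G M.L v)

/-- All aggregations of `M` belong to the set `A`. -/
def MPNN.UsesAggs (M : MPNN) (A : Set Agg) : Prop :=
  ∀ i < M.L, (M.layers i).locIn ∈ A ∧ (M.layers i).locOut ∈ A ∧ (M.layers i).glob ∈ A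

/-- `M` belongs to the class `M_mean`. -/
def MPNN.IsMean (M : MPNN) : Prop := M.UsesAggs {Agg.mean}

/-- `M` recognises `φ` over the class `Cls` with certainty `c(|V|)`. -/
def Recognises {k : ℕ} (M : MPNN) (φ : PML k)
    (Cls : (G : Graph k) → Fin G.n → Prop) (c : ℕ → ℚ) : Prop :=
  ∀ (G : Graph k) (v : Fin G.n), Cls G v →
    (PML.sat G φ v = true → M.out G v = c G.n) ∧
    (PML.sat G φ v = false → M.out G v = 0)

end PMLMPNN
namespace PMLMPNN


/-! ### Piecewise linear functions and FNNs -/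

/-- Closure of a set of functions under affine operations and ReLU. -/
inductive PL {X : Type} (B : Set (X → ℚ)) : (X → ℚ) → Prop where
  | base {f : X → ℚ} : f ∈ B → PL B f
  | const (c : ℚ) : PL B (fun _ => c)
  | add {f g : X → ℚ} : PL B f → PL B g → PL B (fun x => f x + g x)
  | smul (c : ℚ) {f : X → ℚ} : PL B f → PL B (fun x => c * f x)
  | relu {f : X → ℚ} : PL B f → PL B (fun x => max 0 (f x))

theorem PL.trans {X : Type} {B B' : Set (X → ℚ)} (h : ∀ f ∈ B, PL B' f) {F : X → ℚ}
    (hF : PL B F) : PL B' F := by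
  induction hF with
  | base hf => exact h _ hf
  | const c => exact .const c
  | add _ _ h1 h2 => exact .add h1 h2
  | smul c _ h1 => exact .smul c h1
  | relu _ h1 => exact .relu h1

theorem PL.mono {X : Type} {B B' : Set (X → ℚ)} (h : B ⊆ B') {F : X → ℚ}
    (hF : PL B F) : PL B' F := hF.trans (fun _ hf => .base (h hf))

theorem PL.sub {X : Type} {B : Set (X → ℚ)} {f g : X → ℚ} (hf : PL B f) (hg : PL B g) :
    PL B (fun x => f x - g x) := by
  have := hf.add (hg.smul (-1))
  convert this using 2
  ring

theorem PL.min {X : Type} {B : Set (X → ℚ)} {f g : X → ℚ} (hf : PL B f) (hg : PL B g) :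
    PL B (fun x => min (f x) (g x)) := by
  have := hf.sub (hf.sub hg).relu
  convert this using 2 with x
  rcases le_total (f x) (g x) with h | h
  · rw [min_eq_left h, max_eq_left (by linarith)]; ring
  · rw [min_eq_right h, max_eq_right (by linarith)]; ring

theorem PL.sum {X : Type} {B : Set (X → ℚ)} {r : ℕ} {f : Fin r → X → ℚ} (hf : ∀ i, PL B (f i)) :
    PL B (fun x => ∑ i, f i x) := by
  induction r with
  | zero => simpa using PL.const (B := B) 0
  | succ r ih =>
    have := (ih (fun i => hf i.castSucc)).add (hf (Fin.last r))
    convert this using 2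
    rw [Fin.sum_univ_castSucc]

def Aff {X : Type} {e m : ℕ} (inp : X → Fin e → ℚ) (M : FNN e m) (F : X → ℚ) : Prop :=
  ∃ (b : ℚ) (w : Fin m → ℚ), ∀ x, F x = b + ∑ i, w i * M.eval (inp x) i

theorem FNN.eval_nonneg : ∀ {e m : ℕ} (M : FNN e m) (x : Fin e → ℚ) (i : Fin m), 0 ≤ M.eval x i
  | _, _, .layer w b, x, i => le_max_left _ _
  | _, _, .comp f g, x, i => FNN.eval_nonneg g _ i

theorem Aff.extend {X : Type} {e m : ℕ} {inp : X → Fin e → ℚ} {M : FNN e m} {g : X → ℚ}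
    (hg : Aff inp M g) : ∃ (m' : ℕ) (M' : FNN e m'), (∀ f, Aff inp M f → Aff inp M' f) ∧
      Aff inp M' (fun x => max 0 (g x)) := by
  obtain ⟨b, w, h⟩ := hg
  let N : FNN m (m + 1) := .layer
    (Fin.snoc (α := fun _ => Fin m → ℚ) (fun i j => if i = j then 1 else 0) w)
    (Fin.snoc (α := fun _ => ℚ) (fun _ => 0) b)
  have h1 : ∀ x (i : Fin m), (FNN.comp M N).eval (inp x) i.castSucc = M.eval (inp x) i := by
    intro x i
    simp [N, FNN.eval, FNN.eval_nonneg]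
  have h2 : ∀ x, (FNN.comp M N).eval (inp x) (Fin.last m) = max 0 (g x) := by
    intro x
    simp [N, FNN.eval, h]
  refine ⟨m + 1, .comp M N, ?_, ?_⟩
  · rintro f ⟨b', w', h'⟩
    refine ⟨b', Fin.snoc (α := fun _ => ℚ) w' 0, fun x => ?_⟩
    rw [Fin.sum_univ_castSucc]
    simp [h1, h']
  · refine ⟨0, Fin.snoc (α := fun _ => ℚ) (fun _ => 0) 1, fun x => ?_⟩
    rw [Fin.sum_univ_castSucc]
    simp [h2]

theorem PL.aff {X : Type} {e : ℕ} {inp : X → Fin e → ℚ} {B : Set (X → ℚ)} {F : X → ℚ}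
    (hF : PL B F) : ∀ {m : ℕ} (M : FNN e m), (∀ f ∈ B, Aff inp M f) →
      ∃ (m' : ℕ) (M' : FNN e m'), (∀ f, Aff inp M f → Aff inp M' f) ∧ Aff inp M' F := by
  induction hF with
  | base hf => exact fun M hM => ⟨_, M, fun _ h => h, hM _ hf⟩
  | const c => exact fun M hM => ⟨_, M, fun _ h => h, c, fun _ => 0, by simp⟩
  | add _ _ ih1 ih2 =>
    intro m M hM
    obtain ⟨m1, M1, h1, h1'⟩ := ih1 M hM
    obtain ⟨m2, M2, h2, h2'⟩ := ih2 M1 (fun f hf => h1 _ (hM f hf))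
    refine ⟨m2, M2, fun f hf => h2 _ (h1 _ hf), ?_⟩
    obtain ⟨b, w, h⟩ := h2 _ h1'
    obtain ⟨b', w', h'⟩ := h2'
    refine ⟨b + b', fun i => w i + w' i, fun x => ?_⟩
    simp only [h, h', add_mul, Finset.sum_add_distrib]
    ring
  | smul c _ ih =>
    intro m M hM
    obtain ⟨m1, M1, h1, b, w, h⟩ := ih M hM
    refine ⟨m1, M1, h1, c * b, fun i => c * w i, fun x => ?_⟩
    simp only [h, mul_add, Finset.mul_sum, mul_assoc]
  | relu _ ih =>
    intro m M hM
    obtain ⟨m1, M1, h1, h1'⟩ := ih M hM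
    obtain ⟨m2, M2, h2, h2'⟩ := h1'.extend
    exact ⟨m2, M2, fun f hf => h2 _ (h1 _ hf), h2'⟩

theorem PL.aff_family {X : Type} {e : ℕ} {inp : X → Fin e → ℚ} {B : Set (X → ℚ)} {r : ℕ}
    {F : Fin r → X → ℚ} (hF : ∀ j, PL B (F j)) {m : ℕ} (M : FNN e m)
    (hM : ∀ f ∈ B, Aff inp M f) :
      ∃ (m' : ℕ) (M' : FNN e m'), (∀ f, Aff inp M f → Aff inp M' f) ∧ ∀ j, Aff inp M' (F j) := by
  induction r with
  | zero => exact ⟨m, M, fun _ h => h, fun j => j.elim0⟩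
  | succ r ih =>
    obtain ⟨m1, M1, h1, h1'⟩ := ih (fun j => hF j.castSucc)
    obtain ⟨m2, M2, h2, h2'⟩ := (hF (Fin.last r)).aff M1 (fun f hf => h1 _ (hM f hf))
    refine ⟨m2, M2, fun f hf => h2 _ (h1 _ hf), fun j => ?_⟩
    induction j using Fin.lastCases with
    | last => exact h2'
    | cast j => exact h2 _ (h1' j)

theorem fnn_of_PL {X : Type} {e r : ℕ} (inp : X → Fin e → ℚ) {F : Fin r → X → ℚ}
    (hF : ∀ j, PL (Set.range (fun i x => inp x i)) (F j)) :
    ∃ N : FNN e r, ∀ x j, N.eval (inp x) j = max 0 (F j x) := by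
  let M : FNN e (e + e) := .layer
    (Fin.append (α := Fin e → ℚ) (fun i j => if i = j then 1 else 0)
      (fun i j => if i = j then -1 else 0)) (fun _ => 0)
  have hM : ∀ f ∈ Set.range (fun i x => inp x i), Aff inp M f := by
    rintro _ ⟨i, rfl⟩
    refine ⟨0, Fin.append (fun j => if j = i then 1 else 0) (fun j => if j = i then -1 else 0),
      fun x => ?_⟩
    rw [Fin.sum_univ_add]
    simp only [Fin.append_left, Fin.append_right, M, FNN.eval]
    simp
    rcases le_total (inp x i) 0 with h | h
    · rw [max_eq_left h, max_eq_right (by linarith)]; ring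
    · rw [max_eq_right h, max_eq_left (by linarith)]; ring
  obtain ⟨m, M', -, h⟩ := PL.aff_family hF M hM
  choose b w h using h
  refine ⟨.comp M' (.layer w b), fun x j => ?_⟩
  simp only [FNN.eval, h]

/-! ### Features -/

abbrev Pt (k : ℕ) : Type := Σ G : Graph k, Fin G.n

def meanF {k : ℕ} (π : Modality) (F : Pt k → ℚ) : Pt k → ℚ :=
  fun x => (∑ u ∈ x.1.modSem x.2 π, F ⟨x.1, u⟩) / ((x.1.modSem x.2 π).card : ℚ)

def AggS {k : ℕ} (S : Set (Pt k → ℚ)) : Set (Pt k → ℚ) :=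
  {H | ∃ π, ∃ F ∈ S, H = meanF π F}

def initF {k : ℕ} (i : Fin k) : Pt k → ℚ := fun x => if x.1.L x.2 i = true then 1 else 0

def Bs (k : ℕ) : ℕ → Set (Pt k → ℚ)
  | 0 => Set.range initF
  | T + 1 => AggS {F | PL (Bs k T) F}

abbrev Lev {k : ℕ} (T : ℕ) (F : Pt k → ℚ) : Prop := PL (Bs k T) F

theorem meanF_id {k : ℕ} (F : Pt k → ℚ) : meanF .id F = F := by
  funext x
  simp [meanF, Graph.modSem]

theorem Lev.mean {k T : ℕ} {F : Pt k → ℚ} (π : Modality) (h : Lev T F) :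
    Lev (T + 1) (meanF π F) := .base ⟨π, F, h, rfl⟩

theorem Lev.succ {k T : ℕ} {F : Pt k → ℚ} (h : Lev T F) : Lev (T + 1) F := by
  have := h.mean .id
  rwa [meanF_id] at this

theorem Lev.mono {k T T' : ℕ} (hT : T ≤ T') {F : Pt k → ℚ} (h : Lev T F) : Lev T' F := by
  induction hT with
  | refl => exact h
  | step _ ih => exact ih.succ

theorem PL.finite {k : ℕ} {S : Set (Pt k → ℚ)} {F : Pt k → ℚ} (h : PL (AggS S) F) :
    ∃ s : Set (Pt k → ℚ), s.Finite ∧ s ⊆ S ∧ PL (AggS s) F := by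
  have key : ∀ s t : Set (Pt k → ℚ), s ⊆ t → AggS s ⊆ AggS t := by
    rintro s t hst _ ⟨π, F, hF, rfl⟩
    exact ⟨π, F, hst hF, rfl⟩
  induction h with
  | base hf =>
    obtain ⟨π, F, hF, rfl⟩ := hf
    exact ⟨{F}, Set.finite_singleton _, by simpa using hF, .base ⟨π, F, rfl, rfl⟩⟩
  | const c => exact ⟨∅, Set.finite_empty, by simp, .const c⟩
  | add _ _ h1 h2 =>
    obtain ⟨s, hs, hs', h⟩ := h1
    obtain ⟨t, ht, ht', h'⟩ := h2
    exact ⟨s ∪ t, hs.union ht, Set.union_subset hs' ht',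
      .add (h.mono (key _ _ Set.subset_union_left)) (h'.mono (key _ _ Set.subset_union_right))⟩
  | smul c _ h1 =>
    obtain ⟨s, hs, hs', h⟩ := h1
    exact ⟨s, hs, hs', .smul c h⟩
  | relu _ h1 =>
    obtain ⟨s, hs, hs', h⟩ := h1
    exact ⟨s, hs, hs', .relu h⟩

theorem PL.finite_family {k r : ℕ} {S : Set (Pt k → ℚ)} {F : Fin r → Pt k → ℚ}
    (h : ∀ j, PL (AggS S) (F j)) :
    ∃ (m : ℕ) (g : Fin m → Pt k → ℚ), (∀ i, g i ∈ S) ∧ ∀ j, PL (AggS (Set.range g)) (F j) := by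
  choose s hs hs' h using fun j => (h j).finite
  obtain ⟨m, g, hg⟩ := (Set.finite_iUnion hs).fin_embedding
  refine ⟨m, g, fun i => ?_, fun j => ?_⟩
  · have : g i ∈ ⋃ j, s j := hg ▸ Set.mem_range_self i
    obtain ⟨j, hj⟩ := Set.mem_iUnion.1 this
    exact hs' j hj
  · rw [hg]
    refine (h j).mono ?_
    rintro _ ⟨π, F, hF, rfl⟩
    exact ⟨π, F, Set.mem_iUnion.2 ⟨j, hF⟩, rfl⟩

/-! ### Realising features by MPNNs -/

noncomputable def MPNN.stateFrom {k : ℕ} (M : MPNN) (G : Graph k)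
    (x : Fin G.n → Fin (M.dims 0) → ℚ) : (i : ℕ) → Fin G.n → Fin (M.dims i) → ℚ
  | 0 => x
  | i + 1 => (M.layers i).step G (M.stateFrom G x i)

theorem MPNN.state_eq {k : ℕ} (M : MPNN) (G : Graph k) (i : ℕ) :
    M.state G i = M.stateFrom G (G.init (M.dims 0)) i := by
  induction i with
  | zero => rfl
  | succ i ih => simp only [MPNN.state, MPNN.stateFrom, ih]

def consDims (d : ℕ) (f : ℕ → ℕ) : ℕ → ℕ
  | 0 => d
  | i + 1 => f i

def consLayers {d : ℕ} (M : MPNN) (l : MPNNLayer d (M.dims 0)) :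
    (i : ℕ) → MPNNLayer (consDims d M.dims i) (consDims d M.dims (i + 1))
  | 0 => l
  | i + 1 => M.layers i

def MPNN.cons {d : ℕ} (M : MPNN) (l : MPNNLayer d (M.dims 0)) : MPNN where
  L := M.L + 1
  dims := consDims d M.dims
  layers := consLayers M l

theorem MPNN.cons_stateFrom {k d : ℕ} (M : MPNN) (l : MPNNLayer d (M.dims 0)) (G : Graph k)
    (x : Fin G.n → Fin d → ℚ) (i : ℕ) :
    (M.cons l).stateFrom G x (i + 1) = M.stateFrom G (l.step G x) i := by
  induction i with
  | zero => rfl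
  | succ i ih =>
    change (M.layers i).step G ((M.cons l).stateFrom G x (i + 1)) = _
    rw [ih]
    rfl

theorem MPNN.cons_isMean {d : ℕ} (M : MPNN) (hM : M.IsMean) (N : FNN (d + d + d + d) (M.dims 0)) :
    (M.cons ⟨N, .mean, .mean, .mean⟩).IsMean := by
  intro i hi
  cases i with
  | zero => exact ⟨rfl, rfl, rfl⟩
  | succ i => exact hM i (Nat.lt_of_succ_lt_succ hi)

/-- The input to the combination function. -/
noncomputable def inpF {k d : ℕ} (s : Fin d → Pt k → ℚ) (x : Pt k) : Fin (d + d + d + d) → ℚ :=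
  Fin.append (Fin.append (Fin.append (fun i => meanF .id (s i) x) (fun i => meanF .ein (s i) x))
    (fun i => meanF .eout (s i) x)) (fun i => meanF .top (s i) x)

theorem step_eq {k d d' : ℕ} (N : FNN (d + d + d + d) d') (s : Fin d → Pt k → ℚ) (G : Graph k)
    (v : Fin G.n) :
    (MPNNLayer.mk N .mean .mean .mean).step G (fun u i => s i ⟨G, u⟩) v
      = N.eval (inpF s ⟨G, v⟩) := by
  have h : ∀ S : Finset (Fin G.n), Agg.mean.eval (S.val.map (fun u i => s i ⟨G, u⟩))
      = fun i => (∑ u ∈ S, s i ⟨G, u⟩) / (S.card : ℚ) := by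
    intro S
    funext i
    simp only [Agg.eval, Multiset.map_map, Multiset.card_map]
    rfl
  unfold MPNNLayer.step inpF
  simp only [h, meanF_id]
  rfl

theorem coord_mem {k d : ℕ} (s : Fin d → Pt k → ℚ) (π : Modality) (i : Fin d) :
    meanF π (s i) ∈ Set.range (fun i x => inpF s x i) := by
  cases π with
  | id => exact ⟨Fin.castAdd d (Fin.castAdd d (Fin.castAdd d i)), by funext x; simp [inpF]⟩
  | ein => exact ⟨Fin.castAdd d (Fin.castAdd d (Fin.natAdd d i)), by
      funext x; simp only [inpF, Fin.append_left, Fin.append_right]⟩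
  | eout => exact ⟨Fin.castAdd d (Fin.natAdd (d + d) i), by funext x; simp [inpF]⟩
  | top => exact ⟨Fin.natAdd (d + d + d) i, by funext x; simp [inpF]⟩

theorem realise {k : ℕ} (T : ℕ) : ∀ (M' : MPNN), M'.IsMean → ∀ F : Fin (M'.dims 0) → Pt k → ℚ,
    (∀ j, Lev T (F j)) → ∃ M : MPNN, M.IsMean ∧ M.dims 0 = k ∧ M.L = M'.L + T + 1 ∧
      ∀ (G : Graph k) (v : Fin G.n), M.out G v =
        lastVal (M'.stateFrom G (fun u j => max 0 (F j ⟨G, u⟩)) M'.L v) := by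
  induction T with
  | zero =>
    intro M' hM' F hF
    have h1 : ∀ j, PL (Set.range (fun i x => inpF (initF (k := k)) x i)) (F j) := by
      intro j
      refine (hF j).trans ?_
      rintro _ ⟨i, rfl⟩
      have := coord_mem (initF (k := k)) .id i
      rw [meanF_id] at this
      exact .base this
    obtain ⟨N, hN⟩ := fnn_of_PL _ h1
    refine ⟨M'.cons ⟨N, .mean, .mean, .mean⟩, M'.cons_isMean hM' N, rfl, rfl, fun G v => ?_⟩
    unfold MPNN.out
    rw [MPNN.state_eq]
    change lastVal ((M'.cons _).stateFrom G (G.init k) (M'.L + 1) v) = _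
    rw [MPNN.cons_stateFrom]
    congr 2
    funext u j
    have : G.init k = fun u i => initF i ⟨G, u⟩ := by
      funext u i
      simp [Graph.init, initF]
    rw [this, step_eq, hN]
  | succ T ih =>
    intro M' hM' F hF
    obtain ⟨m, g, hg, hF'⟩ := PL.finite_family hF
    let h : Fin (m + m) → Pt k → ℚ := Fin.append g (fun i x => -1 * g i x)
    have hh : ∀ j, Lev T (h j) := by
      intro j
      induction j using Fin.addCases with
      | left i => simpa [h] using hg i
      | right i => simp only [h, Fin.append_right]; exact PL.smul (-1) (hg i)
    let s : Fin (m + m) → Pt k → ℚ := fun j x => max 0 (h j x)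
    have h1 : ∀ j, PL (Set.range (fun i x => inpF s x i)) (F j) := by
      intro j
      refine (hF' j).trans ?_
      rintro _ ⟨π, _, ⟨i, rfl⟩, rfl⟩
      have := (PL.base (coord_mem s π (Fin.castAdd m i))).sub
        (PL.base (coord_mem s π (Fin.natAdd m i)))
      convert this using 1
      funext x
      simp only [meanF, s, h, Fin.append_left, Fin.append_right]
      rw [← sub_div, ← Finset.sum_sub_distrib]
      congr 1
      refine Finset.sum_congr rfl fun u _ => ?_
      rcases le_total (g i ⟨x.1, u⟩) 0 with h | h
      · rw [max_eq_left h, max_eq_right (by linarith)]; ring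
      · rw [max_eq_right h, max_eq_left (by linarith)]; ring
    obtain ⟨N, hN⟩ := fnn_of_PL _ h1
    obtain ⟨M, hM1, hM2, hM3, hM4⟩ :=
      ih (M'.cons ⟨N, .mean, .mean, .mean⟩) (M'.cons_isMean hM' N) h hh
    refine ⟨M, hM1, hM2, ?_, fun G v => ?_⟩
    · rw [hM3]
      change M'.L + 1 + T + 1 = _
      ring
    · rw [hM4]
      change lastVal ((M'.cons _).stateFrom G (fun u j => s j ⟨G, u⟩) (M'.L + 1) v) = _
      refine (congrArg (fun z => lastVal (z v)) (MPNN.cons_stateFrom M' _ G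
        (fun u j => s j ⟨G, u⟩) M'.L)).trans ?_
      congr 2
      funext u j
      rw [step_eq, hN]

theorem realise_one {k : ℕ} (T : ℕ) (F : Pt k → ℚ) (hF : Lev T F) :
    ∃ M : MPNN, M.IsMean ∧ M.dims 0 = k ∧ M.L = T + 1 ∧
      ∀ (G : Graph k) (v : Fin G.n), M.out G v = max 0 (F ⟨G, v⟩) := by
  let M' : MPNN := ⟨0, fun _ => 1, fun _ =>
    ⟨.layer (fun _ _ => 0) (fun _ => 0), .mean, .mean, .mean⟩⟩
  obtain ⟨M, h1, h2, h3, h4⟩ := realise T M' (fun i hi => absurd hi (Nat.not_lt_zero i))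
    (fun _ => F) (fun _ => hF)
  refine ⟨M, h1, h2, ?_, fun G v => ?_⟩
  · rw [h3]; simp [M']
  · rw [h4]
    rfl

/-! ### Arithmetic with features -/

def bcF {k : ℕ} (p : Fin k) (x : Pt k → ℚ) : Pt k → ℚ :=
  meanF .top (fun y => max 0 (min (x y) 1 + initF p y - 1))

def opF {k : ℕ} (p : Fin k) (σ : Modality) (a x : Pt k → ℚ) : Pt k → ℚ :=
  meanF σ (fun y => max 0 (bcF p x y + a y - 1))

theorem lev_init {k : ℕ} (p : Fin k) (T : ℕ) : Lev T (initF p) :=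
  Lev.mono (Nat.zero_le T) (PL.base ⟨p, rfl⟩)

theorem lev_op {k T : ℕ} (p : Fin k) (σ : Modality) {a x : Pt k → ℚ} (ha : Lev 0 a)
    (hx : Lev T x) : Lev (T + 2) (opF p σ a x) := by
  refine Lev.mean (T := T + 1) σ ?_
  refine PL.relu (PL.sub (PL.add ?_ (ha.mono (Nat.zero_le _))) (.const 1))
  refine Lev.mean (T := T) .top ?_
  exact PL.relu (PL.sub (PL.add (PL.min hx (.const 1)) (lev_init p T)) (.const 1))

def cnt {k : ℕ} (G : Graph k) (v : Fin G.n) (σ : Modality) (A : Fin G.n → Bool) : ℕ :=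
  ((G.modSem v σ).filter (fun u => A u = true)).card

theorem mem_modSem {k : ℕ} {G : Graph k} {v : Fin G.n} {p : Fin k} (h : G.StronglyMarkedBy v p)
    (σ : Modality) : v ∈ G.modSem v σ := by
  have := h.2
  cases σ <;> simp [Graph.modSem, Graph.neighIn, Graph.neighOut, this]

theorem cnt_mark {k : ℕ} {G : Graph k} {v : Fin G.n} {p : Fin k} (h : G.StronglyMarkedBy v p)
    (σ : Modality) : cnt G v σ (fun u => G.L u p) = 1 := by
  unfold cnt
  rw [Finset.card_eq_one]
  refine ⟨v, ?_⟩
  ext u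
  rw [Finset.mem_filter, h.1 u, Finset.mem_singleton]
  exact ⟨fun h => h.2, fun e => ⟨e ▸ mem_modSem h σ, e⟩⟩

theorem bc_val {k : ℕ} {G : Graph k} {v : Fin G.n} {p : Fin k} (h : G.StronglyMarkedBy v p)
    {x : Pt k → ℚ} (h0 : 0 ≤ x ⟨G, v⟩) (h1 : x ⟨G, v⟩ ≤ 1) (u : Fin G.n) :
    bcF p x ⟨G, u⟩ = x ⟨G, v⟩ / G.n := by
  simp only [bcF, meanF, Graph.modSem, Finset.card_univ, Fintype.card_fin]
  congr 1
  rw [Finset.sum_eq_single v]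
  · have : initF p (⟨G, v⟩ : Pt k) = 1 := by simp [initF, (h.1 v).2 rfl]
    rw [this, min_eq_left h1, max_eq_right (by linarith)]
    ring
  · intro w _ hw
    have : initF p (⟨G, w⟩ : Pt k) = 0 := by
      simp only [initF]
      rw [if_neg (fun e => hw ((h.1 w).1 e))]
    rw [this, max_eq_left]
    have := min_le_right (x ⟨G, w⟩) 1
    linarith
  · simp

theorem op_val {k : ℕ} {G : Graph k} {v : Fin G.n} {p : Fin k} (h : G.StronglyMarkedBy v p)
    {x a : Pt k → ℚ} (σ : Modality) (A : Fin G.n → Bool)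
    (ha : ∀ u, a ⟨G, u⟩ = if A u = true then 1 else 0)
    (h0 : 0 ≤ x ⟨G, v⟩) (h1 : x ⟨G, v⟩ ≤ 1) :
    opF p σ a x ⟨G, v⟩ = x ⟨G, v⟩ * cnt G v σ A / (G.n * (G.modSem v σ).card) ∧
    0 ≤ opF p σ a x ⟨G, v⟩ ∧ opF p σ a x ⟨G, v⟩ ≤ 1 := by
  have hn : (1 : ℚ) ≤ G.n := by exact_mod_cast Nat.one_le_of_lt v.2
  have hs : (1 : ℚ) ≤ (G.modSem v σ).card := by
    exact_mod_cast Finset.card_pos.2 ⟨v, mem_modSem h σ⟩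
  have hc : (cnt G v σ A : ℚ) ≤ (G.modSem v σ).card := by
    exact_mod_cast Finset.card_filter_le _ _
  have hc0 : (0 : ℚ) ≤ cnt G v σ A := Nat.cast_nonneg _
  have hx : x ⟨G, v⟩ / G.n ≤ 1 := by
    rw [div_le_one (by linarith)]; linarith
  have hx0 : 0 ≤ x ⟨G, v⟩ / G.n := div_nonneg h0 (by linarith)
  have key : opF p σ a x ⟨G, v⟩ = x ⟨G, v⟩ * cnt G v σ A / (G.n * (G.modSem v σ).card) := by
    have : ∀ u, max 0 (bcF p x ⟨G, u⟩ + a ⟨G, u⟩ - 1)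
        = if A u = true then x ⟨G, v⟩ / G.n else 0 := by
      intro u
      rw [bc_val h h0 h1, ha]
      split_ifs
      · rw [max_eq_right (by linarith)]; ring
      · rw [max_eq_left (by linarith)]
    simp only [opF]
    unfold meanF
    simp only [this]
    rw [← Finset.sum_filter, Finset.sum_const, nsmul_eq_mul]
    change (cnt G v σ A : ℚ) * _ / _ = _
    field_simp
  refine ⟨key, ?_, ?_⟩
  · rw [key]; positivity
  · rw [key, div_le_one (by positivity)]
    calc x ⟨G, v⟩ * cnt G v σ A ≤ 1 * (G.modSem v σ).card :=
          mul_le_mul h1 hc hc0 zero_le_one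
      _ ≤ G.n * (G.modSem v σ).card := mul_le_mul_of_nonneg_right hn (by linarith)

/-- Multiplication of the value `x` by the count of `f` along `π`, up to the factor `1/W`. -/
def stepF {k : ℕ} (p : Fin k) (π : Modality) (f x : Pt k → ℚ) : Pt k → ℚ :=
  let sel : Modality → Pt k → ℚ := fun σ => if σ = π then f else initF p
  opF p .id (sel .id) (opF p .ein (sel .ein) (opF p .eout (sel .eout) (opF p .top (sel .top) x)))

theorem lev_step {k T : ℕ} (p : Fin k) (π : Modality) {f x : Pt k → ℚ} (hf : Lev 0 f)
    (hx : Lev T x) : Lev (T + 8) (stepF p π f x) := by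
  have hs : ∀ σ : Modality, Lev 0 (if σ = π then f else initF p) := by
    intro σ
    split_ifs
    · exact hf
    · exact lev_init p 0
  exact lev_op p _ (hs _) (lev_op p _ (hs _) (lev_op p _ (hs _) (lev_op p _ (hs _) hx)))

def wt {k : ℕ} (G : Graph k) (v : Fin G.n) : ℚ :=
  (G.n * (G.modSem v .id).card) * (G.n * (G.modSem v .ein).card) *
    (G.n * (G.modSem v .eout).card) * (G.n * (G.modSem v .top).card)

theorem wt_bounds {k : ℕ} {G : Graph k} {v : Fin G.n} {p : Fin k} (h : G.StronglyMarkedBy v p) :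
    1 ≤ wt G v ∧ wt G v ≤ (G.n : ℚ) ^ 8 := by
  have hn : 1 ≤ G.n := Nat.one_le_of_lt v.2
  have hs : ∀ σ, 1 ≤ (G.modSem v σ).card := fun σ => Finset.card_pos.2 ⟨v, mem_modSem h σ⟩
  have hs' : ∀ σ, (G.modSem v σ).card ≤ G.n := fun σ => by
    simpa using Finset.card_le_univ (G.modSem v σ)
  have e1 : ∀ σ, 1 ≤ G.n * (G.modSem v σ).card := fun σ => Nat.mul_pos hn (hs σ)
  have e2 : ∀ σ, G.n * (G.modSem v σ).card ≤ G.n ^ 2 := fun σ => by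
    rw [sq]; exact Nat.mul_le_mul_left _ (hs' σ)
  unfold wt
  constructor
  · exact_mod_cast Nat.mul_pos (Nat.mul_pos (Nat.mul_pos (e1 .id) (e1 .ein)) (e1 .eout)) (e1 .top)
  · have := Nat.mul_le_mul (Nat.mul_le_mul (Nat.mul_le_mul (e2 .id) (e2 .ein)) (e2 .eout)) (e2 .top)
    have e : G.n ^ 2 * G.n ^ 2 * G.n ^ 2 * G.n ^ 2 = G.n ^ 8 := by ring
    rw [e] at this
    exact_mod_cast this

theorem step_val {k : ℕ} {G : Graph k} {v : Fin G.n} {p : Fin k} (h : G.StronglyMarkedBy v p)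
    {x f : Pt k → ℚ} (π : Modality) (A : Fin G.n → Bool)
    (hf : ∀ u, f ⟨G, u⟩ = if A u = true then 1 else 0)
    (h0 : 0 ≤ x ⟨G, v⟩) (h1 : x ⟨G, v⟩ ≤ 1) :
    stepF p π f x ⟨G, v⟩ = x ⟨G, v⟩ * cnt G v π A / wt G v ∧
    0 ≤ stepF p π f x ⟨G, v⟩ ∧ stepF p π f x ⟨G, v⟩ ≤ 1 := by
  let Q : Modality → Fin G.n → Bool := fun σ => if σ = π then A else fun u => G.L u p
  have hs : ∀ (σ : Modality) u, (if σ = π then f else initF p) (⟨G, u⟩ : Pt k)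
      = if Q σ u = true then 1 else 0 := by
    intro σ u
    by_cases e : σ = π
    · simp only [Q, if_pos e]; exact hf u
    · simp only [Q, if_neg e]; rfl
  obtain ⟨a1, b1, c1⟩ := op_val h .top (Q .top) (hs .top) h0 h1
  obtain ⟨a2, b2, c2⟩ := op_val h .eout (Q .eout) (hs .eout) b1 c1
  obtain ⟨a3, b3, c3⟩ := op_val h .ein (Q .ein) (hs .ein) b2 c2
  obtain ⟨a4, b4, c4⟩ := op_val h .id (Q .id) (hs .id) b3 c3
  refine ⟨?_, b4, c4⟩
  have hp : (cnt G v .top (Q .top) : ℚ) * cnt G v .eout (Q .eout) * cnt G v .ein (Q .ein)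
      * cnt G v .id (Q .id) = cnt G v π A := by
    have hm := cnt_mark h
    cases π <;> simp [Q, hm]
  rw [← hp]
  refine a4.trans ?_
  rw [a3, a2, a1]
  unfold wt
  simp only [div_eq_mul_inv, mul_inv]
  ring

/-- Iterated products. -/
def prodF {k : ℕ} (p : Fin k) : List (Modality × (Pt k → ℚ)) → Pt k → ℚ
  | [] => fun _ => 1
  | t :: l => stepF p t.1 t.2 (prodF p l)

theorem lev_prod {k : ℕ} (p : Fin k) (l : List (Modality × (Pt k → ℚ)))
    (hl : ∀ t ∈ l, Lev 0 t.2) : Lev (8 * l.length) (prodF p l) := by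
  induction l with
  | nil => exact .const 1
  | cons t l ih =>
    have := lev_step p t.1 (hl t (by simp)) (ih (fun t ht => hl t (by simp [ht])))
    rw [List.length_cons, Nat.mul_add]
    exact this

/-- Padded monomial. -/
def monF {k m : ℕ} (p : Fin k) (π : Fin m → Modality) (f : Fin m → Pt k → ℚ) (D : ℕ)
    (l : List (Fin m)) : Pt k → ℚ :=
  prodF p (l.map (fun j => (π j, f j)) ++ List.replicate (D - l.length) (.id, initF p))

theorem lev_mon {k m : ℕ} (p : Fin k) (π : Fin m → Modality) {f : Fin m → Pt k → ℚ} {D : ℕ}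
    (hf : ∀ j, Lev 0 (f j)) {l : List (Fin m)} (hl : l.length ≤ D) :
    Lev (8 * D) (monF p π f D l) := by
  have := lev_prod p (l.map (fun j => (π j, f j)) ++ List.replicate (D - l.length) (.id, initF p))
    (by
      intro t ht
      rcases List.mem_append.1 ht with ht | ht
      · obtain ⟨j, -, rfl⟩ := List.mem_map.1 ht
        exact hf j
      · rw [List.eq_of_mem_replicate ht]
        exact lev_init p 0)
  unfold monF
  simpa [hl] using this

theorem pad_val {k : ℕ} {G : Graph k} {v : Fin G.n} {p : Fin k} (h : G.StronglyMarkedBy v p)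
    (r : ℕ) : prodF p (List.replicate r (.id, initF p)) ⟨G, v⟩ = 1 / wt G v ^ r ∧
      0 ≤ prodF p (List.replicate r (.id, initF p)) ⟨G, v⟩ ∧
      prodF p (List.replicate r (.id, initF p)) ⟨G, v⟩ ≤ 1 := by
  induction r with
  | zero => simp [prodF]
  | succ r ih =>
    obtain ⟨a, b, c⟩ := ih
    have := step_val h .id (fun u => G.L u p) (f := initF p) (fun u => rfl) b c
    refine ⟨?_, this.2⟩
    refine this.1.trans ?_
    rw [a, cnt_mark h, pow_succ]
    simp only [div_eq_mul_inv, mul_inv]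
    simp

theorem mon_val {k m : ℕ} {G : Graph k} {v : Fin G.n} {p : Fin k} (h : G.StronglyMarkedBy v p)
    (π : Fin m → Modality) {f : Fin m → Pt k → ℚ} (A : Fin m → Fin G.n → Bool)
    (hf : ∀ j u, f j ⟨G, u⟩ = if A j u = true then 1 else 0) (D : ℕ)
    (l : List (Fin m)) (hl : l.length ≤ D) :
    monF p π f D l ⟨G, v⟩
      = (monValZ (fun j => cnt G v (π j) (A j)) l : ℚ) / wt G v ^ D := by
  have key : ∀ (l : List (Fin m)) (r : ℕ),
      prodF p (l.map (fun j => (π j, f j)) ++ List.replicate r (.id, initF p)) ⟨G, v⟩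
        = (monValZ (fun j => cnt G v (π j) (A j)) l : ℚ) / wt G v ^ (l.length + r) ∧
      0 ≤ prodF p (l.map (fun j => (π j, f j)) ++ List.replicate r (.id, initF p)) ⟨G, v⟩ ∧
      prodF p (l.map (fun j => (π j, f j)) ++ List.replicate r (.id, initF p)) ⟨G, v⟩ ≤ 1 := by
    intro l r
    induction l with
    | nil => simpa [monValZ] using pad_val h r
    | cons j l ih =>
      obtain ⟨a, b, c⟩ := ih
      have := step_val h (π j) (A j) (f := f j) (hf j) b c
      refine ⟨?_, this.2⟩
      refine this.1.trans ?_
      rw [a, List.length_cons, Nat.add_right_comm, pow_succ]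
      simp only [div_eq_mul_inv, mul_inv, monValZ, List.map_cons, List.prod_cons]
      push_cast
      ring
  have := (key l (D - l.length)).1
  rw [Nat.add_sub_cancel' hl] at this
  exact this

/-- The unit `1/n^(2r)`. -/
def unitF {k : ℕ} (p : Fin k) : ℕ → Pt k → ℚ
  | 0 => fun _ => 1
  | r + 1 => opF p .top (initF p) (unitF p r)

theorem lev_unit {k : ℕ} (p : Fin k) (r : ℕ) : Lev (2 * r) (unitF p r) := by
  induction r with
  | zero => exact .const 1
  | succ r ih => exact lev_op p .top (lev_init p 0) ih

theorem unit_val {k : ℕ} {G : Graph k} {v : Fin G.n} {p : Fin k} (h : G.StronglyMarkedBy v p)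
    (r : ℕ) : unitF p r ⟨G, v⟩ = 1 / (G.n : ℚ) ^ (2 * r) ∧
      0 ≤ unitF p r ⟨G, v⟩ ∧ unitF p r ⟨G, v⟩ ≤ 1 := by
  induction r with
  | zero => simp [unitF]
  | succ r ih =>
    obtain ⟨a, b, c⟩ := ih
    have := op_val h .top (fun u => G.L u p) (a := initF p) (fun u => rfl) b c
    refine ⟨?_, this.2⟩
    refine this.1.trans ?_
    rw [a, cnt_mark h, Nat.mul_succ, pow_add]
    simp only [Graph.modSem, Finset.card_univ, Fintype.card_fin, div_eq_mul_inv, mul_inv, sq]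
    simp

/-! ### Formulas -/

theorem prop_feat {k : ℕ} (φ : PML k) (hφ : φ.md = 0) :
    ∃ f : Pt k → ℚ, Lev 0 f ∧ ∀ G u, f ⟨G, u⟩ = if PML.sat G φ u = true then 1 else 0 := by
  induction φ with
  | prop i => exact ⟨initF i, lev_init i 0, fun G u => rfl⟩
  | not φ ih =>
    obtain ⟨f, h1, h2⟩ := ih hφ
    refine ⟨fun x => 1 - f x, (PL.const 1).sub h1, fun G u => ?_⟩
    simp only [h2, PML.sat]
    rcases Bool.eq_false_or_eq_true (PML.sat G φ u) with hb | hb <;> simp [hb]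
  | and φ₁ φ₂ ih1 ih2 =>
    simp only [PML.md] at hφ
    obtain ⟨f, h1, h2⟩ := ih1 (by omega)
    obtain ⟨g, h3, h4⟩ := ih2 (by omega)
    refine ⟨fun x => max 0 (f x + g x - 1), ((h1.add h3).sub (.const 1)).relu, fun G u => ?_⟩
    simp only [h2, h4, PML.sat]
    rcases Bool.eq_false_or_eq_true (PML.sat G φ₁ u) with hb | hb <;>
      rcases Bool.eq_false_or_eq_true (PML.sat G φ₂ u) with hb' | hb' <;> simp [hb, hb']
  | modal m π ψ φs ih =>
    simp only [PML.md] at hφ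
    omega

theorem peano_feat {k m : ℕ} (p : Fin k) (π : Fin m → Modality) (φs : Fin m → PML k)
    (hφ : ∀ j, (φs j).md = 0) (D : ℕ) (ψ : PeanoFormula m) (hψ : ψ.deg ≤ D) :
    ∃ f : Pt k → ℚ, Lev (8 * D) f ∧ ∀ G v, G.StronglyMarkedBy v p →
      f ⟨G, v⟩ = if ψ.sat (fun i => cnt G v (π i) (PML.sat G (φs i))) = true
        then 1 / wt G v ^ D else 0 := by
  choose g hg1 hg2 using fun j => prop_feat (φs j) (hφ j)
  have hy1 : Lev (8 * D) (monF p π g D []) := lev_mon p π hg1 (Nat.zero_le D)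
  have hy2 : ∀ G v, G.StronglyMarkedBy v p → monF p π g D [] ⟨G, v⟩ = 1 / wt G v ^ D := by
    intro G v h
    rw [mon_val h π (fun j => PML.sat G (φs j)) (fun j u => hg2 j G u) D [] (Nat.zero_le D)]
    simp [monValZ]
  have hpos : ∀ (G : Graph k) (v : Fin G.n), G.StronglyMarkedBy v p → 0 < 1 / wt G v ^ D := by
    intro G v h
    have := (wt_bounds h).1
    positivity
  induction ψ with
  | ineq t =>
    have hl : ∀ i, (t.mon i).length ≤ D := fun i =>
      (Finset.le_sup (f := fun i => (t.mon i).length) (Finset.mem_univ i)).trans hψ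
    refine ⟨fun x => min (monF p π g D [] x) (max 0 ((t.b + 1 : ℚ) * monF p π g D [] x -
      ∑ i, (t.a i : ℚ) * monF p π g D (t.mon i) x)),
      hy1.min ((hy1.smul _).sub (PL.sum fun i => (lev_mon p π hg1 (hl i)).smul _)).relu, ?_⟩
    intro G v h
    have hp := hpos G v h
    have hv := fun i => mon_val h π (fun j => PML.sat G (φs j)) (fun j u => hg2 j G u) D
      (t.mon i) (hl i)
    simp only [hy2 G v h, hv]
    set c : Fin m → ℕ := fun i => cnt G v (π i) (PML.sat G (φs i)) with hc
    have e : ((t.b : ℚ) + 1) * (1 / wt G v ^ D) - ∑ i, (t.a i : ℚ) *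
        ((monValZ c (t.mon i) : ℚ) / wt G v ^ D)
        = ((t.b + 1 - ∑ i, t.a i * monValZ c (t.mon i) : ℤ) : ℚ) * (1 / wt G v ^ D) := by
      push_cast
      rw [sub_mul, Finset.sum_mul]
      congr 1
      refine Finset.sum_congr rfl fun i _ => ?_
      ring
    rw [e]
    simp only [PeanoFormula.sat, PeanoIneq.sat, decide_eq_true_eq]
    split_ifs with hs
    · have : (1 : ℚ) ≤ ((t.b + 1 - ∑ i, t.a i * monValZ c (t.mon i) : ℤ) : ℚ) := by
        exact_mod_cast (by linarith : (1 : ℤ) ≤ t.b + 1 - ∑ i, t.a i * monValZ c (t.mon i))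
      exact min_eq_left (le_max_of_le_right (le_mul_of_one_le_left hp.le this))
    · have : ((t.b + 1 - ∑ i, t.a i * monValZ c (t.mon i) : ℤ) : ℚ) ≤ 0 := by
        have : t.b + 1 - ∑ i, t.a i * monValZ c (t.mon i) ≤ 0 := by
          push Not at hs
          linarith [Int.add_one_le_iff.2 hs]
        exact_mod_cast this
      rw [max_eq_left (mul_nonpos_of_nonpos_of_nonneg this hp.le), min_eq_right hp.le]
  | not ψ ih =>
    obtain ⟨f, h1, h2⟩ := ih hψ
    refine ⟨fun x => monF p π g D [] x - f x, hy1.sub h1, fun G v h => ?_⟩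
    simp only [h2 G v h, hy2 G v h, PeanoFormula.sat]
    rcases Bool.eq_false_or_eq_true (PeanoFormula.sat (fun i => cnt G v (π i) (PML.sat G (φs i))) ψ) with hb | hb <;>
      simp [hb]
  | and ψ₁ ψ₂ ih1 ih2 =>
    simp only [PeanoFormula.deg] at hψ
    obtain ⟨f, h1, h2⟩ := ih1 (by omega)
    obtain ⟨f', h1', h2'⟩ := ih2 (by omega)
    refine ⟨fun x => max 0 (f x + f' x - monF p π g D [] x),
      ((h1.add h1').sub hy1).relu, fun G v h => ?_⟩
    have hp := (hpos G v h).le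
    simp only [h2 G v h, h2' G v h, hy2 G v h, PeanoFormula.sat]
    rcases Bool.eq_false_or_eq_true (PeanoFormula.sat (fun i => cnt G v (π i) (PML.sat G (φs i))) ψ₁) with hb | hb <;>
      rcases Bool.eq_false_or_eq_true (PeanoFormula.sat (fun i => cnt G v (π i) (PML.sat G (φs i))) ψ₂) with hb' | hb' <;>
      simpa [hb, hb'] using hp

theorem pml_feat {k : ℕ} (p : Fin k) (D : ℕ) (φ : PML k) (hφ : φ.md ≤ 1) (hD : φ.deg ≤ D) :
    ∃ f : Pt k → ℚ, Lev (8 * D) f ∧ ∀ G v, G.StronglyMarkedBy v p →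
      f ⟨G, v⟩ = if PML.sat G φ v = true then 1 / wt G v ^ D else 0 := by
  have hy1 : Lev (8 * D) (prodF p (List.replicate D (.id, initF p))) := by
    have := lev_prod p (List.replicate D (.id, initF p)) (by
      intro t ht
      rw [List.eq_of_mem_replicate ht]
      exact lev_init p 0)
    simpa using this
  have hpos : ∀ (G : Graph k) (v : Fin G.n), G.StronglyMarkedBy v p → 0 < 1 / wt G v ^ D := by
    intro G v h
    have := (wt_bounds h).1
    positivity
  induction φ with
  | prop i =>
    refine ⟨fun x => min (prodF p (List.replicate D (.id, initF p)) x) (initF i x),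
      hy1.min (lev_init i _), fun G v h => ?_⟩
    have h3 := pad_val h D
    have hp := (hpos G v h).le
    change min _ (if G.L v i = true then (1 : ℚ) else 0)
      = if G.L v i = true then 1 / wt G v ^ D else 0
    rcases Bool.eq_false_or_eq_true (G.L v i) with hb | hb
    · rw [if_pos hb, if_pos hb, min_eq_left h3.2.2, h3.1]
    · rw [if_neg (by simp [hb]), if_neg (by simp [hb]), min_eq_right h3.2.1]
  | not φ ih =>
    obtain ⟨f, h1, h2⟩ := ih hφ hD
    refine ⟨fun x => prodF p (List.replicate D (.id, initF p)) x - f x, hy1.sub h1,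
      fun G v h => ?_⟩
    simp only [h2 G v h, (pad_val h D).1, PML.sat]
    rcases Bool.eq_false_or_eq_true (PML.sat G φ v) with hb | hb <;> simp [hb]
  | and φ₁ φ₂ ih1 ih2 =>
    simp only [PML.deg] at hD
    simp only [PML.md] at hφ
    obtain ⟨f, h1, h2⟩ := ih1 (by omega) (by omega)
    obtain ⟨f', h1', h2'⟩ := ih2 (by omega) (by omega)
    refine ⟨fun x => max 0 (f x + f' x - prodF p (List.replicate D (.id, initF p)) x),
      ((h1.add h1').sub hy1).relu, fun G v h => ?_⟩
    have hp := (hpos G v h).le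
    simp only [h2 G v h, h2' G v h, (pad_val h D).1, PML.sat]
    rcases Bool.eq_false_or_eq_true (PML.sat G φ₁ v) with hb | hb <;>
      rcases Bool.eq_false_or_eq_true (PML.sat G φ₂ v) with hb' | hb' <;> simpa [hb, hb'] using hp
  | modal m π ψ φs ih =>
    simp only [PML.deg] at hD
    simp only [PML.md] at hφ
    have hm : ∀ j, (φs j).md = 0 := by
      intro j
      have := Finset.le_sup (f := fun i => (φs i).md) (Finset.mem_univ j)
      omega
    obtain ⟨f, h1, h2⟩ := peano_feat p π φs hm D ψ (le_trans (le_max_left _ _) hD)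
    exact ⟨f, h1, fun G v h => h2 G v h⟩

/-- there is a constant `C` such that every `φ ∈ PML₁`
(arbitrary modalities) is recognised, over regular pointed graphs whose focus
is strongly marked by colour `p`, by a mean MPNN with at most `C·(deg(φ)+1)`
layers with certainty `1/|V|^e` for some `e ≤ C·(deg(φ)+1)`. -/
theorem statement5 :
    ∃ C : ℕ, ∀ (k : ℕ) (p : Fin k) (φ : PML k), φ.md ≤ 1 →
      ∃ (M : MPNN) (e : ℕ), M.IsMean ∧ M.dims 0 = k ∧
        M.L ≤ C * (φ.deg + 1) ∧ e ≤ C * (φ.deg + 1) ∧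
        Recognises M φ (fun G v => G.Regular ∧ G.StronglyMarkedBy v p)
          (fun n => 1 / (n : ℚ) ^ e) := by
  refine ⟨8, fun k p φ hφ => ?_⟩
  obtain ⟨f, h1, h2⟩ := pml_feat p φ.deg φ hφ le_rfl
  have hu : Lev (8 * φ.deg) (unitF p (4 * φ.deg)) := by
    have := lev_unit p (4 * φ.deg)
    rwa [← mul_assoc] at this
  obtain ⟨M, hM1, hM2, hM3, hM4⟩ := realise_one (8 * φ.deg) _ (h1.min hu)
  refine ⟨M, 8 * φ.deg, hM1, hM2, by omega, by omega, ?_⟩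
  rintro G v ⟨-, h⟩
  have hv := (unit_val h (4 * φ.deg)).1
  rw [← mul_assoc] at hv
  have hn : (0 : ℚ) < G.n := by exact_mod_cast Nat.zero_lt_of_lt v.2
  have hp : (0 : ℚ) < 1 / (G.n : ℚ) ^ (8 * φ.deg) := by positivity
  have hw := wt_bounds h
  have hle : 1 / (G.n : ℚ) ^ (8 * φ.deg) ≤ 1 / wt G v ^ φ.deg := by
    rw [pow_mul]
    exact one_div_le_one_div_of_le (by linarith [pow_pos (lt_of_lt_of_le one_pos hw.1) φ.deg])
      (pow_le_pow_left₀ (by linarith) hw.2 _)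
  rw [hM4]
  simp only [h2 G v h, hv]
  norm_num only at hp hle ⊢
  constructor
  · intro hs
    rw [if_pos hs, min_eq_right hle, max_eq_right hp.le]
  · intro hs
    rw [if_neg (by simp [hs]), min_eq_left hp.le, max_self]

end PMLMPNN
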